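/- Let 𝒢 be a groupoid with object set M and 𝒜 its discrete convolution algebra, and let χ be the characteristic map sending a function φ on 𝒢_k to the (k+1)-linear functional χ(φ)(a₀,…,a_k) = Σ_{(g₁,…,g_k) ∈ 𝒢_k} a₀((g₁⋯g_k)⁻¹) φ(g₁,…,g_k) a₁(g₁) ⋯ a_k(g_k). Then χ intertwines the differentiable-cochain differential with the Hochschild coboundary: for every k ≥ 0 and every φ : 𝒢_k → ℂ, χ(dφ) = b(χ(φ)), where dφ(g₁,…,g_{k+1}) = φ(g₂,…,g_{k+1}) + Σ_{i=1}^{k} (−1)^i φ(g₁,…,g_ig_{i+1},…,g_{k+1}) + (−1)^{k+1} φ(g₁,…,g_k) for k ≥ 1, dφ(g) = φ(t(g)) − φ(s(g)) for k = 0, and (bF)(a₀,…,a_{k+1}) = Σ_{i=0}^{k} (−1)^i F(a₀,…,a_i * a_{i+1},…,a_{k+1}) + (−1)^{k+1} F(a_{k+1} * a₀, a₁,…,a_k). -/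

import Mathlib

/-!
STATEMENT 5: For a groupoid 𝒢 with discrete convolution algebra 𝒜, the
characteristic map χ(φ)(a₀,…,a_k) = Σ_{(g₁,…,g_k) ∈ 𝒢_k} a₀((g₁⋯g_k)⁻¹)
φ(g₁,…,g_k) a₁(g₁) ⋯ a_k(g_k) intertwines the differentiable-cochain
differential d with the Hochschild coboundary b:  χ(dφ) = b(χ(φ)) for every
k ≥ 0 and φ : 𝒢_k → ℂ.  Here dφ = Σ_{i=0}^{k+1} (−1)^i φ∘∂_i (which is
dφ(g₁,…,g_{k+1}) = φ(g₂,…,g_{k+1}) + Σ_{i=1}^{k} (−1)^i φ(g₁,…,gᵢgᵢ₊₁,…,g_{k+1})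
+ (−1)^{k+1} φ(g₁,…,g_k), and dφ(g) = φ(t(g)) − φ(s(g)) for k = 0), and
(bF)(a₀,…,a_{k+1}) = Σ_{i=0}^{k} (−1)^i F(a₀,…,aᵢ*aᵢ₊₁,…,a_{k+1})
+ (−1)^{k+1} F(a_{k+1}*a₀, a₁,…,a_k).

We model 𝒢_k as `CategoryTheory.ComposableArrows C k` (so 𝒢_0 is the set of
0-tuples, canonically the objects); ∂_i deletes the i-th vertex.
-/

open CategoryTheory

/-- The type of arrows of a groupoid. -/
abbrev GrpdArrow (C : Type*) [Groupoid C] := Σ x : C, Σ y : C, x ⟶ y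

/-- Convolution product: (f₁ * f₂)(g) = Σ_{g₁g₂ = g} f₁(g₁) f₂(g₂). -/
noncomputable def grpdConv {C : Type*} [Groupoid C]
    (f₁ f₂ : GrpdArrow C → ℂ) : GrpdArrow C → ℂ :=
  fun g => ∑ᶠ (z : C) (a : g.1 ⟶ z) (b : z ⟶ g.2.1) (_ : a ≫ b = g.2.2),
    f₁ ⟨g.1, z, a⟩ * f₂ ⟨z, g.2.1, b⟩

/-- The `i`-th simplicial face map ∂_i : 𝒢_{n+1} → 𝒢_n (deleting the i-th vertex). -/
def faceMap {C : Type*} [Groupoid C] {n : ℕ} (i : Fin (n + 2))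
    (F : ComposableArrows C (n + 1)) : ComposableArrows C n :=
  F.whiskerLeft (Monotone.functor (Fin.strictMono_succAbove i).monotone)

/-- The differentiable groupoid cohomology differential dφ = Σ_{i=0}^{k+1} (−1)^i φ∘∂_i. -/
noncomputable def diffD {C : Type*} [Groupoid C] {k : ℕ}
    (φ : ComposableArrows C k → ℂ) (F : ComposableArrows C (k + 1)) : ℂ :=
  ∑ i : Fin (k + 2), (-1 : ℂ) ^ (i : ℕ) * φ (faceMap i F)

/-- The characteristic map χ(φ)(a₀,…,a_k). -/
noncomputable def chiMap {C : Type*} [Groupoid C] {k : ℕ}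
    (φ : ComposableArrows C k → ℂ) (a : Fin (k + 1) → GrpdArrow C → ℂ) : ℂ :=
  ∑ᶠ F : ComposableArrows C k,
    a 0 ⟨F.obj (Fin.last k), F.obj 0, Groupoid.inv (F.map' 0 k)⟩ * φ F *
      ∏ i : Fin k,
        a i.succ ⟨F.obj i.castSucc, F.obj i.succ,
          F.map (homOfLE (Fin.castSucc_lt_succ (i := i)).le)⟩

/-- The tuple (a₀,…,aᵢ*aᵢ₊₁,…,a_{k+1}) obtained by convolving the i-th and (i+1)-st entries. -/
noncomputable def contractAt {C : Type*} [Groupoid C] {k : ℕ} (i : Fin (k + 1))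
    (a : Fin (k + 2) → GrpdArrow C → ℂ) : Fin (k + 1) → GrpdArrow C → ℂ :=
  fun j =>
    if (j : ℕ) < (i : ℕ) then a j.castSucc
    else if (j : ℕ) = (i : ℕ) then grpdConv (a j.castSucc) (a j.succ)
    else a j.succ

/-- The tuple (a_{k+1} * a₀, a₁, …, a_k). -/
noncomputable def wrapAround {C : Type*} [Groupoid C] {k : ℕ}
    (a : Fin (k + 2) → GrpdArrow C → ℂ) : Fin (k + 1) → GrpdArrow C → ℂ :=
  Fin.cons (grpdConv (a (Fin.last (k + 1))) (a 0))
    (fun j : Fin k => a j.succ.castSucc)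

section ChiAux

universe u v

lemma chiAux_finsum_sigma {ι : Type*} {β : ι → Type*} (f : (Σ i, β i) → ℂ)
    (hf : (Function.support f).Finite) : ∑ᶠ p, f p = ∑ᶠ i, ∑ᶠ b, f ⟨i, b⟩ := by
  classical
  rw [finsum_eq_sum_of_support_subset (s := hf.toFinset) f (by simp),
    ← finsum_sum_filter Sigma.fst]
  refine finsum_congr fun i => ?_
  have h2 : (Function.support fun b => f ⟨i, b⟩).Finite :=
    hf.preimage (f := fun b => (⟨i, b⟩ : Σ i, β i)) (sigma_mk_injective.injOn)
  rw [finsum_eq_sum_of_support_subset (s := h2.toFinset) _ (by simp)]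
  symm
  refine Finset.sum_bij (fun b _ => (⟨i, b⟩ : Σ i, β i)) ?_ ?_ ?_ ?_
  · intro b hb
    simpa using hb
  · intro b _ b' _ h
    exact sigma_mk_injective h
  · rintro ⟨j, b⟩ hb
    simp only [Finset.mem_filter, Set.Finite.mem_toFinset] at hb
    obtain ⟨hb, rfl⟩ := hb
    exact ⟨b, by simpa using hb, rfl⟩
  · intros; rfl

variable {C : Type u} [Groupoid.{v} C]

/-- arrows out of `x` -/
abbrev ChiStar (x : C) := Σ y : C, x ⟶ y

/-- difference of two arrows out of `x` -/
def chiD {x : C} (p q : ChiStar x) : GrpdArrow C := ⟨p.1, q.1, Groupoid.inv p.2 ≫ q.2⟩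

/-- the composable string determined by a family of arrows out of `x` -/
def chiOf {n : ℕ} (x : C) (h : Fin (n + 1) → ChiStar x) : ComposableArrows C n where
  obj j := (h j).1
  map {i j} _ := Groupoid.inv (h i).2 ≫ (h j).2
  map_id := by simp
  map_comp := by simp

/-- arrows from the initial vertex -/
def chiSt {n : ℕ} (F : ComposableArrows C n) (j : Fin (n + 1)) : ChiStar (F.obj 0) :=
  ⟨F.obj j, F.map (homOfLE (Fin.zero_le j))⟩

lemma chiOf_chiSt {n : ℕ} (F : ComposableArrows C n) : chiOf (F.obj 0) (chiSt F) = F := by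
  refine CategoryTheory.Functor.hext (fun _ => rfl) ?_
  intro i j f
  refine heq_of_eq ?_
  have : F.map (homOfLE (Fin.zero_le j)) = F.map (homOfLE (Fin.zero_le i)) ≫ F.map f := by
    rw [← F.map_comp]; rfl
  simp [chiOf, chiSt, this]

/-- the arrow from vertex p to vertex q -/
def chiA {n : ℕ} (F : ComposableArrows C n) (p q : Fin (n + 1)) : GrpdArrow C :=
  chiD (chiSt F p) (chiSt F q)

lemma chiA_chiOf {n : ℕ} (x : C) (h : Fin (n + 1) → ChiStar x) (p q : Fin (n + 1)) :
    chiA (chiOf x h) p q = chiD (h p) (h q) := by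
  simp [chiA, chiD, chiSt, chiOf]

/-- cyclic predecessor -/
def chiCyc {n : ℕ} : Fin (n + 1) → Fin (n + 1) := Fin.cases (Fin.last n) Fin.castSucc

lemma chiCyc_val {n : ℕ} (j : Fin (n + 1)) :
    (chiCyc j : ℕ) = if (j : ℕ) = 0 then n else j - 1 := by
  refine Fin.cases ?_ (fun j => ?_) j <;> simp [chiCyc]

/-- the weight -/
noncomputable def chiW {n : ℕ} (a : Fin (n + 1) → GrpdArrow C → ℂ)
    (F : ComposableArrows C n) : ℂ := ∏ j, a j (chiA F (chiCyc j) j)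

lemma chiA_succ {n : ℕ} (F : ComposableArrows C n) (p q : Fin (n + 1)) (hpq : p ≤ q) :
    chiA F p q = ⟨F.obj p, F.obj q, F.map (homOfLE hpq)⟩ := by
  have : F.map (homOfLE (Fin.zero_le q)) = F.map (homOfLE (Fin.zero_le p)) ≫
      F.map (homOfLE hpq) := by
    rw [← F.map_comp]; rfl
  simp [chiA, chiD, chiSt, this]

lemma chiA_zero {n : ℕ} (F : ComposableArrows C n) :
    chiA F (Fin.last n) 0 =
      ⟨F.obj (Fin.last n), F.obj 0, Groupoid.inv (F.map' 0 n)⟩ := by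
  have h0 : F.map (homOfLE (Fin.zero_le (0 : Fin (n + 1)))) = 𝟙 _ := F.map_id _
  have : Groupoid.inv (F.map (homOfLE (Fin.zero_le (Fin.last n)))) ≫
      F.map (homOfLE (Fin.zero_le (0 : Fin (n + 1)))) =
      Groupoid.inv (F.map (homOfLE (Fin.zero_le (Fin.last n)))) := by
    rw [h0, Category.comp_id]
  simp only [chiA, chiD, chiSt]
  rw [this]
  rfl

lemma chiMap_eq {k : ℕ} (φ : ComposableArrows C k → ℂ) (a : Fin (k + 1) → GrpdArrow C → ℂ) :
    chiMap φ a = ∑ᶠ F : ComposableArrows C k, φ F * chiW a F := by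
  refine finsum_congr fun F => ?_
  rw [chiW, Fin.prod_univ_succ]
  have h0 : chiA F (chiCyc 0) 0 = _ := chiA_zero F
  have h1 : ∀ i : Fin k, chiA F (chiCyc i.succ) i.succ = _ :=
    fun i => chiA_succ F i.castSucc i.succ (Fin.castSucc_lt_succ (i := i)).le
  simp only [h0, h1]
  ring

lemma chi_inj {n : ℕ} {F G : ComposableArrows C n}
    (h : ∀ j, chiA F (chiCyc j) j = chiA G (chiCyc j) j) : F = G := by
  have aux : ∀ {x y x' y' : C} {f : x ⟶ y} {f' : x' ⟶ y'} (hx : x = x') (hy : y = y'),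
      (⟨x, y, f⟩ : GrpdArrow C) = ⟨x', y', f'⟩ → f = eqToHom hx ≫ f' ≫ eqToHom hy.symm := by
    intro x y x' y' f f' hx hy e
    subst hx; subst hy
    simpa using e
  have ho : ∀ j, F.obj j = G.obj j := fun j => congrArg (fun g : GrpdArrow C => g.2.1) (h j)
  refine ComposableArrows.ext ho fun i hi => ?_
  have h1 := h (⟨i, hi⟩ : Fin n).succ
  have e : ∀ F : ComposableArrows C n, chiA F (chiCyc (⟨i, hi⟩ : Fin n).succ)
    (⟨i, hi⟩ : Fin n).succ = _ := fun F =>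
      chiA_succ F (⟨i, hi⟩ : Fin n).castSucc (⟨i, hi⟩ : Fin n).succ (Fin.castSucc_lt_succ).le
  rw [e F, e G] at h1
  exact aux (ho (⟨i, hi⟩ : Fin n).castSucc) (ho (⟨i, hi⟩ : Fin n).succ) h1

lemma chiW_finite {n : ℕ} (a : Fin (n + 1) → GrpdArrow C → ℂ)
    (ha : ∀ i, (Function.support (a i)).Finite) :
    (Function.support (chiW a)).Finite := by
  have h1 := Set.Finite.pi ha
  refine (h1.preimage (f := fun (F : ComposableArrows C n) j => chiA F (chiCyc j) j) ?_).subset ?_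
  · intro F _ G _ h
    exact chi_inj fun j => congrFun h j
  · intro F hF
    simp only [Function.mem_support, chiW, Finset.prod_ne_zero_iff] at hF
    simpa using hF

lemma chi_cancel {x y z w : C} (c : x ⟶ y) (p : x ⟶ z) (q : x ⟶ w) :
    Groupoid.inv (Groupoid.inv c ≫ p) ≫ Groupoid.inv c ≫ q = Groupoid.inv p ≫ q := by
  simp

/-- insert a vertex -/
def chiIns {k : ℕ} (i : Fin (k + 2)) (p : Σ G : ComposableArrows C k, ChiStar (G.obj 0)) :
    ComposableArrows C (k + 1) :=
  chiOf (p.1.obj 0) (i.insertNth (α := fun _ => ChiStar (p.1.obj 0)) p.2 (chiSt p.1))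

lemma faceMap_chiOf {k : ℕ} (i : Fin (k + 2)) (x : C) (h : Fin (k + 2) → ChiStar x) :
    faceMap i (chiOf x h) = chiOf x (fun j => h (i.succAbove j)) := rfl

lemma faceMap_chiIns {k : ℕ} (i : Fin (k + 2))
    (p : Σ G : ComposableArrows C k, ChiStar (G.obj 0)) : faceMap i (chiIns i p) = p.1 := by
  rw [chiIns, faceMap_chiOf]
  simp only [Fin.insertNth_apply_succAbove]
  exact chiOf_chiSt _

lemma chiIns_bij {k : ℕ} (i : Fin (k + 2)) : Function.Bijective (chiIns (C := C) i) := by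
  constructor
  · rintro ⟨G, r⟩ ⟨G', r'⟩ h
    have h1 := congrArg (faceMap i) h
    rw [faceMap_chiIns, faceMap_chiIns] at h1
    obtain rfl : G = G' := h1
    have h2 := congrArg (fun F => chiA F (i.succAbove 0) i) h
    simp only [chiIns, chiA_chiOf, Fin.insertNth_apply_succAbove, Fin.insertNth_apply_same] at h2
    have h3 : chiSt G 0 = ⟨G.obj 0, 𝟙 _⟩ := by
      have h0 : G.map (homOfLE (Fin.zero_le (0 : Fin (k + 1)))) = 𝟙 _ := G.map_id _
      simp only [chiSt]
      rw [h0]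
    rw [h3] at h2
    obtain ⟨y, f⟩ := r
    obtain ⟨y', f'⟩ := r'
    have h4 : (⟨G.obj 0, y, f⟩ : GrpdArrow C) = ⟨G.obj 0, y', f'⟩ := by
      have e : Groupoid.inv (𝟙 (G.obj 0)) = 𝟙 _ := by simp
      simpa [chiD, e] using h2
    have h5 : (⟨y, f⟩ : ChiStar (G.obj 0)) = ⟨y', f'⟩ := by
      simpa using h4
    rw [h5]
  · intro F
    let s : ChiStar (F.obj 0) → ChiStar (F.obj (i.succAbove 0)) :=
      fun r => ⟨r.1, Groupoid.inv (chiSt F (i.succAbove 0)).2 ≫ r.2⟩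
    refine ⟨⟨faceMap i F, s (chiSt F i)⟩, ?_⟩
    have h1 : chiSt (faceMap i F) = fun j => s (chiSt F (i.succAbove j)) := by
      funext j
      have h0 : i.succAbove 0 ≤ i.succAbove j :=
        (Fin.strictMono_succAbove i).monotone (Fin.zero_le j)
      have : F.map (homOfLE (Fin.zero_le (i.succAbove j))) =
          F.map (homOfLE (Fin.zero_le (i.succAbove 0))) ≫ F.map (homOfLE h0) := by
        rw [← F.map_comp]; rfl
      simp only [s, chiSt, this]
      simp
      rfl
    have h2 : (i.insertNth (α := fun _ => ChiStar ((faceMap i F).obj 0)) (s (chiSt F i))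
        (chiSt (faceMap i F))) = fun j => s (chiSt F j) := by
      rw [h1]
      exact Fin.insertNth_self_removeNth i (fun j => s (chiSt F j))
    rw [chiIns]
    simp only [h2]
    conv_rhs => rw [← chiOf_chiSt F]
    refine CategoryTheory.Functor.hext (fun _ => rfl) ?_
    intro p q f
    refine heq_of_eq ?_
    exact chi_cancel (chiSt F (i.succAbove 0)).2 (chiSt F p).2 (chiSt F q).2

lemma chi_conv {x : C} (f g : GrpdArrow C → ℂ) (hf : (Function.support f).Finite)
    (p q : ChiStar x) :
    grpdConv f g (chiD p q) = ∑ᶠ r : ChiStar x, f (chiD p r) * g (chiD r q) := by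
  classical
  have h1 : grpdConv f g (chiD p q) = ∑ᶠ (z : C) (a : p.1 ⟶ z),
      f ⟨p.1, z, a⟩ * g ⟨z, q.1, Groupoid.inv a ≫ Groupoid.inv p.2 ≫ q.2⟩ := by
    refine finsum_congr fun z => finsum_congr fun (a : p.1 ⟶ z) => ?_
    change ∑ᶠ (b : z ⟶ q.1) (_ : a ≫ b = Groupoid.inv p.2 ≫ q.2),
      f ⟨p.1, z, a⟩ * g ⟨z, q.1, b⟩ = _
    rw [finsum_eq_single _ (Groupoid.inv a ≫ Groupoid.inv p.2 ≫ q.2)]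
    · rw [finsum_eq_if, if_pos (by simp)]
    · intro b hb
      rw [finsum_eq_if, if_neg]
      rintro h
      apply hb
      have : a ≫ b = Groupoid.inv p.2 ≫ q.2 := h
      rw [← this]; simp
  rw [h1]
  rw [← chiAux_finsum_sigma (fun r : ChiStar p.1 => f ⟨p.1, r.1, r.2⟩ *
    g ⟨r.1, q.1, Groupoid.inv r.2 ≫ Groupoid.inv p.2 ≫ q.2⟩)]
  · symm
    refine finsum_eq_of_bijective (fun r : ChiStar x => (⟨r.1, Groupoid.inv p.2 ≫ r.2⟩ :
      ChiStar p.1)) ?_ ?_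
    · rw [Function.bijective_iff_has_inverse]
      refine ⟨fun r => ⟨r.1, p.2 ≫ r.2⟩, ?_, ?_⟩
      · rintro ⟨y, r⟩; simp
      · rintro ⟨y, r⟩; simp
    · rintro ⟨y, r⟩
      have : Groupoid.inv (Groupoid.inv p.2 ≫ r) ≫ Groupoid.inv p.2 ≫ q.2 =
        Groupoid.inv r ≫ q.2 := by simp
      simp only [chiD, this]
  · refine (hf.preimage (f := fun r : ChiStar p.1 => (⟨p.1, r.1, r.2⟩ : GrpdArrow C)) ?_).subset ?_
    · rintro ⟨y, r⟩ _ ⟨y', r'⟩ _ h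
      simpa using h
    · intro r hr
      exact left_ne_zero_of_mul hr

lemma chiCyc_succAbove {k : ℕ} (i j : Fin (k + 1)) (h : j ≠ i) :
    chiCyc (i.castSucc.succAbove j) = i.castSucc.succAbove (chiCyc j) := by
  have h' : (j : ℕ) ≠ i := fun e => h (Fin.ext e)
  ext
  have := chiCyc_val j
  simp only [Fin.succAbove, Fin.lt_def, Fin.val_castSucc]
  rw [chiCyc_val]
  grind

lemma chi_key_cast {k : ℕ} (i : Fin (k + 1)) (a : Fin (k + 2) → GrpdArrow C → ℂ)
    (ha : ∀ i, (Function.support (a i)).Finite) (G : ComposableArrows C k) :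
    ∑ᶠ r : ChiStar (G.obj 0), chiW a (chiIns i.castSucc ⟨G, r⟩) = chiW (contractAt i a) G := by
  classical
  rw [chiW, ← Finset.mul_prod_erase _ _ (Finset.mem_univ i)]
  have h1 : contractAt i a i = grpdConv (a i.castSucc) (a i.succ) := by simp [contractAt]
  rw [h1, chiA, chi_conv _ _ (ha _), finsum_mul]
  refine finsum_congr fun r => ?_
  rw [chiW, Fin.prod_univ_succAbove _ i.castSucc, ← Finset.mul_prod_erase _ _ (Finset.mem_univ i),
    ← mul_assoc]
  have hs : ∀ j, i.castSucc.insertNth (α := fun _ => ChiStar (G.obj 0)) r (chiSt G)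
    (i.castSucc.succAbove j) = chiSt G j := fun j => Fin.insertNth_apply_succAbove _ _ _ _
  have e1 : chiCyc i.castSucc = i.castSucc.succAbove (chiCyc i) := by
    ext
    have := chiCyc_val i
    simp only [Fin.succAbove, Fin.lt_def, Fin.val_castSucc]
    rw [chiCyc_val]
    grind
  have e2 : i.castSucc.succAbove i = i.succ := by simp
  have e3 : chiCyc i.succ = i.castSucc := rfl
  congr 1
  · simp only [chiIns, chiA_chiOf]
    rw [e1, hs, hs, e2, e3, Fin.insertNth_apply_same]
  · refine Finset.prod_congr rfl fun j hj => ?_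
    have hj := Finset.ne_of_mem_erase hj
    have h' : (j : ℕ) ≠ i := fun e => hj (Fin.ext e)
    simp only [chiIns, chiA_chiOf]
    rw [chiCyc_succAbove i j hj, hs, hs]
    simp only [contractAt, chiA, Fin.succAbove, Fin.lt_def, Fin.val_castSucc]
    split_ifs <;> rfl

lemma chi_key_last {k : ℕ} (a : Fin (k + 2) → GrpdArrow C → ℂ)
    (ha : ∀ i, (Function.support (a i)).Finite) (G : ComposableArrows C k) :
    ∑ᶠ r : ChiStar (G.obj 0), chiW a (chiIns (Fin.last (k + 1)) ⟨G, r⟩)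
      = chiW (wrapAround a) G := by
  rw [chiW, Fin.prod_univ_succ]
  have h1 : wrapAround a 0 = grpdConv (a (Fin.last (k + 1))) (a 0) := rfl
  rw [h1, chiA, chi_conv _ _ (ha _), finsum_mul]
  refine finsum_congr fun r => ?_
  rw [chiW, Fin.prod_univ_succAbove _ (Fin.last (k + 1)), Fin.prod_univ_succ, ← mul_assoc]
  have hs : ∀ j : Fin (k + 1), (Fin.last (k + 1)).insertNth (α := fun _ => ChiStar (G.obj 0)) r
    (chiSt G) j.castSucc = chiSt G j := fun j => by
      rw [← Fin.succAbove_last]; exact Fin.insertNth_apply_succAbove _ _ _ _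
  have e1 : chiCyc (Fin.last (k + 1)) = (Fin.last k).castSucc := rfl
  have e2 : chiCyc (0 : Fin (k + 1)) = Fin.last k := rfl
  have e3 : chiCyc (Fin.castSucc (0 : Fin (k + 1))) = Fin.last (k + 1) := rfl
  congr 1
  · simp only [chiIns, chiA_chiOf, Fin.succAbove_last]
    rw [e1, e2, e3, hs, hs, Fin.insertNth_apply_same]
    rfl
  · refine Finset.prod_congr rfl fun j _ => ?_
    have e4 : chiCyc j.succ.castSucc = (chiCyc j.succ).castSucc := rfl
    simp only [chiIns, chiA_chiOf, Fin.succAbove_last]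
    rw [e4, hs, hs]
    rfl

lemma chi_fiber {k : ℕ} (i : Fin (k + 2)) (φ : ComposableArrows C k → ℂ)
    (a : Fin (k + 2) → GrpdArrow C → ℂ) (ha : ∀ i, (Function.support (a i)).Finite) :
    ∑ᶠ F, φ (faceMap i F) * chiW a F =
      ∑ᶠ G, φ G * ∑ᶠ r : ChiStar (G.obj 0), chiW a (chiIns i ⟨G, r⟩) := by
  have h1 : ∑ᶠ p, φ p.1 * chiW a (chiIns i p) = ∑ᶠ F, φ (faceMap i F) * chiW a F :=
    finsum_eq_of_bijective (chiIns i) (chiIns_bij i) fun p => by rw [faceMap_chiIns]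
  rw [← h1, chiAux_finsum_sigma]
  · exact finsum_congr fun G => by rw [mul_finsum]
  · refine ((chiW_finite a ha).preimage (chiIns_bij i).1.injOn).subset fun p hp => ?_
    exact right_ne_zero_of_mul hp

end ChiAux

/-- χ intertwines d with the Hochschild coboundary b: χ(dφ) = b(χ(φ)). -/
theorem chiMap_diffD {C : Type*} [Groupoid C] (k : ℕ)
    (φ : ComposableArrows C k → ℂ)
    (a : Fin (k + 2) → GrpdArrow C → ℂ)
    (ha : ∀ i, (Function.support (a i)).Finite) :
    chiMap (diffD φ) a
      = (∑ i : Fin (k + 1), (-1 : ℂ) ^ (i : ℕ) * chiMap φ (contractAt i a))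
        + (-1 : ℂ) ^ (k + 1) * chiMap φ (wrapAround a) := by
  have hD : chiMap (diffD φ) a
      = ∑ i : Fin (k + 2), (-1 : ℂ) ^ (i : ℕ) * ∑ᶠ F, φ (faceMap i F) * chiW a F := by
    rw [chiMap_eq]
    simp only [mul_finsum, diffD, Finset.sum_mul]
    rw [finsum_sum_comm]
    · simp only [mul_assoc]
    · intro i _
      exact (chiW_finite a ha).subset fun F hF => right_ne_zero_of_mul hF
  rw [hD, Fin.sum_univ_castSucc]
  simp only [chi_fiber _ φ a ha, chi_key_cast _ a ha, chi_key_last a ha, chiMap_eq,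
    Fin.val_castSucc, Fin.val_last]
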